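/- arXiv:2001.08627 — 2 statements merged into one kernel-verified Lean document; each statement's English description precedes it below -/
import Mathlib

section
/- Let φ be a semiflow on E satisfying (H1), (H2) with j = 2, (H3), (COM) and (S), with amenable set 𝔄. If a periodic orbit γ₀ ⊆ 𝔄 is amenable stable, then γ₀ is orbitally stable. -/
open Set Filter Topology MeasureTheory Bornology

/-- A semiflow on a Banach space `E`. -/
structure Semiflow (E : Type*) [NormedAddCommGroup E] [NormedSpace ℝ E] where
  toFun : ℝ → E → E
  map_zero' : ∀ v : E, toFun 0 v = v
  map_add' : ∀ t s : ℝ, 0 ≤ t → 0 ≤ s → ∀ v : E, toFun (t + s) v = toFun t (toFun s v)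
  continuousOn' : ContinuousOn (fun p : ℝ × E => toFun p.1 p.2) (Set.Ici (0 : ℝ) ×ˢ Set.univ)

/-- The open `r`-neighborhood `O_r(γ)` of a set `γ` in a normed space. -/
def setNbhd {E : Type*} [NormedAddCommGroup E] (γ : Set E) (r : ℝ) : Set E :=
  {v | ∃ w ∈ γ, ‖v - w‖ < r}

/-- `S` is an `ε`-section at `x₀` of the (partial) flow `ξ` on the set `M`. -/
def IsSectionOn {X : Type*} [TopologicalSpace X] (M : Set X) (ξ : ℝ → X → X)
    (ε : ℝ) (x₀ : X) (S : Set X) : Prop :=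
  x₀ ∈ S ∧ S ⊆ M ∧
    (∃ W : Set X, IsOpen W ∧ x₀ ∈ W ∧
      W ∩ M ⊆ ⋃ t ∈ Set.Icc (-ε) ε, ξ t '' S) ∧
    ∀ y ∈ ⋃ t ∈ Set.Icc (-ε) ε, ξ t '' S,
      ∃! p : ℝ × X, p.1 ∈ Set.Icc (-ε) ε ∧ p.2 ∈ S ∧ ξ p.1 p.2 = y

/-- `T` is an `ε`-transversal at `x₀` of the (partial) flow `ξ` on the set `M`:
an `ε`-section which is the image of a topological embedding of `[-1,1]`,
with `x₀` corresponding to an interior point. -/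
def IsTransversalOn {X : Type*} [TopologicalSpace X] (M : Set X) (ξ : ℝ → X → X)
    (ε : ℝ) (x₀ : X) (T : Set X) : Prop :=
  IsSectionOn M ξ ε x₀ T ∧
    ∃ h : ℝ → X, ContinuousOn h (Set.Icc (-1 : ℝ) 1) ∧ Set.InjOn h (Set.Icc (-1 : ℝ) 1) ∧
      h '' Set.Icc (-1 : ℝ) 1 = T ∧ ∃ s₀ ∈ Set.Ioo (-1 : ℝ) 1, h s₀ = x₀

namespace Semiflow

variable {E : Type*} [NormedAddCommGroup E] [NormedSpace ℝ E]
variable {H : Type*} [NormedAddCommGroup H] [InnerProductSpace ℝ H]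

/-- A stationary point of the semiflow. -/
def IsStationary (φ : Semiflow E) (v₀ : E) : Prop :=
  ∀ t : ℝ, 0 ≤ t → φ.toFun t v₀ = v₀

/-- A periodic (non-stationary) point of the semiflow. -/
def IsPeriodicPt (φ : Semiflow E) (v₀ : E) : Prop :=
  ¬ φ.IsStationary v₀ ∧ ∃ σ : ℝ, 0 < σ ∧ φ.toFun σ v₀ = v₀

/-- The positive semi-orbit `γ⁺(v₀)` (which equals the full orbit for periodic points). -/
def orbit (φ : Semiflow E) (v₀ : E) : Set E :=
  {w | ∃ t : ℝ, 0 ≤ t ∧ φ.toFun t v₀ = w}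

/-- `γ` is a periodic orbit of the semiflow. -/
def IsPeriodicOrbit (φ : Semiflow E) (γ : Set E) : Prop :=
  ∃ v₀ : E, φ.IsPeriodicPt v₀ ∧ γ = φ.orbit v₀

/-- The ω-limit set of a point. -/
def omegaLimit (φ : Semiflow E) (v₀ : E) : Set E :=
  ⋂ s ∈ Set.Ici (0 : ℝ), closure {w | ∃ t : ℝ, s ≤ t ∧ φ.toFun t v₀ = w}

/-- A complete trajectory of the semiflow. -/
def IsCompleteTrajectory (φ : Semiflow E) (v : ℝ → E) : Prop :=
  Continuous v ∧ ∀ t : ℝ, 0 ≤ t → ∀ s : ℝ, v (t + s) = φ.toFun t (v s)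

/-- The α-limit set of a complete trajectory. -/
def alphaLimitOf (φ : Semiflow E) (v : ℝ → E) : Set E :=
  ⋂ s ∈ Set.Iic (0 : ℝ), closure {w | ∃ t : ℝ, t ≤ s ∧ v t = w}

/-- Hypothesis (H1): `P` is symmetric and positive on `Eplus`, negative on `Eminus`,
with `E = Eplus ⊕ Eminus`. -/
def IsH1 (P : E →L[ℝ] E →L[ℝ] ℝ) (Eplus Eminus : Submodule ℝ E) : Prop :=
  (∀ v w : E, P v w = P w v) ∧ IsClosed (Eplus : Set E) ∧ IsClosed (Eminus : Set E) ∧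
    IsCompl Eplus Eminus ∧
    (∀ v ∈ Eplus, v ≠ 0 → 0 < P v v) ∧ (∀ v ∈ Eminus, v ≠ 0 → P v v < 0)

/-- Hypothesis (H3): squeezing with respect to `V(v) = ⟨v, Pv⟩`, with parameters
`δ > 0`, `τV ≥ 0`, `ν > 0`; the embedding `E ↪ H` is `ι`. -/
def IsH3 (φ : Semiflow E) (ι : E →L[ℝ] H) (P : E →L[ℝ] E →L[ℝ] ℝ) (δ τV ν : ℝ) : Prop :=
  0 < δ ∧ 0 ≤ τV ∧ 0 < ν ∧
    ∀ v₁ v₂ : E, ∀ l r : ℝ, 0 ≤ l → l ≤ r → τV ≤ r - l →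
      Real.exp (2 * ν * r) *
          P (φ.toFun r v₁ - φ.toFun r v₂) (φ.toFun r v₁ - φ.toFun r v₂) -
        Real.exp (2 * ν * l) *
          P (φ.toFun l v₁ - φ.toFun l v₂) (φ.toFun l v₁ - φ.toFun l v₂) ≤
      -δ * ∫ s in l..r, Real.exp (2 * ν * s) * ‖ι (φ.toFun s v₁) - ι (φ.toFun s v₂)‖ ^ 2

/-- Hypothesis (COM): some time-`τ` map takes bounded sets to precompact sets. -/
def IsCOM (φ : Semiflow E) : Prop :=
  ∃ τ : ℝ, 0 < τ ∧ ∀ B : Set E, IsBounded B → IsCompact (closure (φ.toFun τ '' B))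

/-- Hypothesis (S): a smoothing estimate from `H` to `E`. -/
def IsSmoothing (φ : Semiflow E) (ι : E →L[ℝ] H) : Prop :=
  ∃ τ C : ℝ, 0 ≤ τ ∧ 0 < C ∧
    ∀ v₁ v₂ : E, ‖φ.toFun τ v₁ - φ.toFun τ v₂‖ ≤ C * ‖ι v₁ - ι v₂‖

/-- An amenable trajectory: a complete trajectory with
`∫_{-∞}^0 e^{2νs} |v(s)|²_H ds < ∞`. -/
def IsAmenableTrajectory (φ : Semiflow E) (ι : E →L[ℝ] H) (ν : ℝ) (v : ℝ → E) : Prop :=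
  φ.IsCompleteTrajectory v ∧
    IntegrableOn (fun s : ℝ => Real.exp (2 * ν * s) * ‖ι (v s)‖ ^ 2) (Set.Iic (0 : ℝ))

/-- The amenable set `𝔄`: points through which an amenable trajectory passes. -/
def amenableSet (φ : Semiflow E) (ι : E →L[ℝ] H) (ν : ℝ) : Set E :=
  {v₀ | ∃ v : ℝ → E, φ.IsAmenableTrajectory ι ν v ∧ v 0 = v₀}

/-- Orbital stability of a set `γ`. -/
def IsOrbitallyStable (φ : Semiflow E) (γ : Set E) : Prop :=
  ∀ ε : ℝ, 0 < ε → ∃ δ : ℝ, 0 < δ ∧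
    ∀ v ∈ setNbhd γ δ, ∀ t : ℝ, 0 ≤ t → φ.toFun t v ∈ setNbhd γ ε

/-- Amenable stability: orbital stability with respect to initial data in `𝔄`. -/
def IsAmenableStable (φ : Semiflow E) (ι : E →L[ℝ] H) (ν : ℝ) (γ : Set E) : Prop :=
  ∀ ε : ℝ, 0 < ε → ∃ δ : ℝ, 0 < δ ∧
    ∀ v ∈ setNbhd γ δ ∩ φ.amenableSet ι ν, ∀ t : ℝ, 0 ≤ t → φ.toFun t v ∈ setNbhd γ ε

/-- Lyapunov stability of a stationary point. -/
def IsLyapunovStable (φ : Semiflow E) (v₀ : E) : Prop :=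
  ∀ ε : ℝ, 0 < ε → ∃ δ : ℝ, 0 < δ ∧
    ∀ v : E, ‖v - v₀‖ < δ → ∀ t : ℝ, 0 ≤ t → ‖φ.toFun t v - v₀‖ < ε

/-- `D` is a `k`-dimensional local unstable set for the stationary point `v₀`:
(U1) `D` is a homeomorphic image of an open `k`-cube; (U2) through every point of `D`
there is a unique complete trajectory, converging to `v₀` as `t → -∞`;
(U3) trajectories through points of `D` near `v₀` stay near `v₀` for `t ≤ 0`. -/
def IsLocalUnstableSet (φ : Semiflow E) (k : ℕ) (v₀ : E) (D : Set E) : Prop :=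
  v₀ ∈ D ∧
    Nonempty (↥(Set.pi Set.univ fun _ : Fin k => Set.Ioo (0 : ℝ) 1) ≃ₜ ↥D) ∧
    (∀ w₀ ∈ D, ∃! w : ℝ → E, φ.IsCompleteTrajectory w ∧ w 0 = w₀) ∧
    (∀ w₀ ∈ D, ∀ w : ℝ → E, φ.IsCompleteTrajectory w → w 0 = w₀ →
      Filter.Tendsto w Filter.atBot (nhds v₀)) ∧
    (∀ ε : ℝ, 0 < ε → ∃ δ : ℝ, 0 < δ ∧ ∀ w₀ ∈ D, ‖w₀ - v₀‖ < δ →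
      ∀ w : ℝ → E, φ.IsCompleteTrajectory w → w 0 = w₀ → ∀ t : ℝ, t ≤ 0 → ‖w t - v₀‖ < ε)

/-- An unstable terminal point: a stationary point with a 2-dimensional local unstable set. -/
def IsUnstableTerminal (φ : Semiflow E) (v₀ : E) : Prop :=
  φ.IsStationary v₀ ∧ ∃ D : Set E, φ.IsLocalUnstableSet 2 v₀ D

/-- A terminal point: a stationary point that is Lyapunov stable or has a
2-dimensional local unstable set. -/
def IsTerminal (φ : Semiflow E) (v₀ : E) : Prop :=
  φ.IsStationary v₀ ∧
    (φ.IsLyapunovStable v₀ ∨ ∃ D : Set E, φ.IsLocalUnstableSet 2 v₀ D)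

/-- An attractor: a bounded closed set with an open neighborhood all of whose points have
precompact positive semi-orbits with ω-limit sets inside the set. -/
def IsAttractor (φ : Semiflow E) (A : Set E) : Prop :=
  IsBounded A ∧ IsClosed A ∧
    ∃ U : Set E, IsOpen U ∧ A ⊆ U ∧
      ∀ v₀ ∈ U, IsCompact (closure (φ.orbit v₀)) ∧ φ.omegaLimit v₀ ⊆ A

/-- `Pi` is the `V`-orthogonal projector onto `Eminus`. -/
def IsVProjector (P : E →L[ℝ] E →L[ℝ] ℝ) (Eminus : Submodule ℝ E) (Pi : E → E) : Prop :=
  ∀ v : E, Pi v ∈ Eminus ∧ ∀ w ∈ Eminus, P w v = P w (Pi v)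

/-- The interior region `𝒢_γ ⊆ 𝔄` of a periodic orbit `γ`: the preimage under `Π`
of the bounded connected component of `E⁻ \ Πγ`. -/
def interiorRegion (φ : Semiflow E) (ι : E →L[ℝ] H) (ν : ℝ) (Eminus : Submodule ℝ E)
    (Pi : E → E) (γ : Set E) : Set E :=
  {a | a ∈ φ.amenableSet ι ν ∧ Pi a ∈ (Eminus : Set E) \ (Pi '' γ) ∧
    IsBounded (connectedComponentIn ((Eminus : Set E) \ (Pi '' γ)) (Pi a))}

/-- The partial order `γ₁ ⩽ γ₂` on periodic orbits: `𝒢_{γ₁} ⊆ 𝒢_{γ₂}`. -/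
def orbitLE (φ : Semiflow E) (ι : E →L[ℝ] H) (ν : ℝ) (Eminus : Submodule ℝ E)
    (Pi : E → E) (γ₁ γ₂ : Set E) : Prop :=
  φ.interiorRegion ι ν Eminus Pi γ₁ ⊆ φ.interiorRegion ι ν Eminus Pi γ₂

/-- External stability of a periodic orbit `γ`. -/
def IsExternallyStable (φ : Semiflow E) (ι : E →L[ℝ] H) (ν : ℝ) (Eminus : Submodule ℝ E)
    (Pi : E → E) (γ : Set E) : Prop :=
  (∃ g : ℕ → Set E, (∀ k, φ.IsPeriodicOrbit (g k)) ∧ (∀ k, g k ≠ γ) ∧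
      (∀ k, φ.orbitLE ι ν Eminus Pi γ (g k)) ∧
      Filter.Tendsto (fun k => Metric.hausdorffDist (g k) γ) Filter.atTop (nhds 0)) ∨
    (∃ v₀ ∈ φ.amenableSet ι ν \ closure (φ.interiorRegion ι ν Eminus Pi γ),
      φ.omegaLimit v₀ = γ)

/-- Internal stability of a periodic orbit `γ`. -/
def IsInternallyStable (φ : Semiflow E) (ι : E →L[ℝ] H) (ν : ℝ) (Eminus : Submodule ℝ E)
    (Pi : E → E) (γ : Set E) : Prop :=
  (∃ g : ℕ → Set E, (∀ k, φ.IsPeriodicOrbit (g k)) ∧ (∀ k, g k ≠ γ) ∧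
      (∀ k, φ.orbitLE ι ν Eminus Pi (g k) γ) ∧
      Filter.Tendsto (fun k => Metric.hausdorffDist (g k) γ) Filter.atTop (nhds 0)) ∨
    (∃ v₀ ∈ φ.interiorRegion ι ν Eminus Pi γ, φ.omegaLimit v₀ = γ)

end Semiflow

/-- A `2π`-periodic family of nonvanishing loops cannot join a constant loop to an odd loop. -/
lemma no_homotopy_const_odd (Φ : ℝ × ℝ → ℂ) (hc : Continuous Φ) (h0 : ∀ x, Φ x ≠ 0)
    (hper : ∀ s θ, Φ (s, θ + 2 * Real.pi) = Φ (s, θ)) (s₁ : ℝ)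
    (hconst : ∀ θ, Φ (0, θ) = Φ (0, 0))
    (hodd : ∀ θ, Φ (s₁, θ + Real.pi) = -Φ (s₁, θ)) : False := by
  obtain ⟨F, ⟨-, hF⟩, -⟩ := Complex.isCoveringMapOn_exp.existsUnique_continuousMap_lifts
    ⟨Φ, hc⟩ (a₀ := (0, 0)) (e₀ := Complex.log (Φ (0, 0))) (Complex.exp_log (h0 _))
    (fun a => by simpa using h0 a)
  have hF' : ∀ x, Complex.exp (F x) = Φ x := fun x => congrFun hF x
  have hFc : Continuous F := F.continuous
  -- a continuous function with `exp` constant is constant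
  have key : ∀ g : ℝ → ℂ, Continuous g → (∀ s t, Complex.exp (g s) = Complex.exp (g t)) →
      ∀ s t, g s = g t := by
    intro g hg he s t
    obtain ⟨K, -, hK⟩ := Complex.isCoveringMapOn_exp.existsUnique_continuousMap_lifts
      ⟨fun _ : ℝ => Complex.exp (g t), continuous_const⟩ (a₀ := t) (e₀ := g t) rfl
      (fun a => by simp)
    have h1 := hK ⟨g, hg⟩ ⟨rfl, by ext x; exact he x t⟩
    have h2 := hK ⟨fun _ => g t, continuous_const⟩ ⟨rfl, by ext x; rfl⟩
    exact DFunLike.congr_fun (h1.trans h2.symm) s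
  have hA : ∀ s t, F (s, 0 + 2 * Real.pi) - F (s, 0) = F (t, 0 + 2 * Real.pi) - F (t, 0) :=
    key (fun s => F (s, 0 + 2 * Real.pi) - F (s, 0)) (by fun_prop) (fun s t => by
      simp only [Complex.exp_sub, hF', hper, div_self (h0 _)])
  have hB : F (0, 0 + 2 * Real.pi) = F (0, 0) :=
    key (fun θ => F (0, θ)) (by fun_prop) (fun s t => by
      simp only [hF']; rw [hconst s, hconst t]) _ _
  have hC : ∀ s t, F (s₁, s + Real.pi) - F (s₁, s) = F (s₁, t + Real.pi) - F (s₁, t) :=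
    key (fun θ => F (s₁, θ + Real.pi) - F (s₁, θ)) (by fun_prop) (fun s t => by
      simp only [Complex.exp_sub, hF', hodd, neg_div, div_self (h0 _)])
  have hD := hA s₁ 0
  rw [hB, sub_self] at hD
  have hE := hC Real.pi 0
  have e1 : F (s₁, Real.pi + Real.pi) = F (s₁, 0) := by
    have : Real.pi + Real.pi = 0 + 2 * Real.pi := by ring
    rw [this]; exact sub_eq_zero.1 hD
  rw [e1, zero_add] at hE
  have e2 : F (s₁, Real.pi) = F (s₁, 0) := by
    linear_combination (-1/2 : ℂ) * hE
  have e3 := hodd 0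
  rw [zero_add, ← hF', ← hF', e2] at e3
  exact Complex.exp_ne_zero (F (s₁, 0)) (by linear_combination (1/2 : ℂ) * e3)

/-- A continuous expansive self-map of the plane is onto. -/
lemma surjective_of_expansive (G : ℂ → ℂ) (hG : Continuous G) (c : ℝ) (hc : 0 < c)
    (hexp : ∀ z w, c * ‖z - w‖ ≤ ‖G z - G w‖) : Function.Surjective G := by
  intro q
  by_contra hq
  push Not at hq
  set R : ℝ := (‖q - G 0‖ + 1) / c with hR
  have hRpos : 0 < R := by positivity
  have hinj : ∀ z w, G z = G w → z = w := by
    intro z w h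
    have := hexp z w
    rw [h, sub_self, norm_zero] at this
    have h2 : ‖z - w‖ ≤ 0 := by
      by_contra hh
      push Not at hh
      nlinarith [mul_pos hc hh]
    exact sub_eq_zero.1 (norm_le_zero_iff.1 h2)
  let cl : ℝ → ℝ := fun x => max 0 (min x 1)
  have hcl : Continuous cl := by fun_prop
  let e : ℝ → ℂ := fun θ => Complex.exp (θ * Complex.I)
  have he : Continuous e := by fun_prop
  have hen : ∀ θ, ‖e θ‖ = 1 := fun θ => Complex.norm_exp_ofReal_mul_I θ
  have hene : ∀ θ, e θ ≠ 0 := fun θ => Complex.exp_ne_zero _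
  have hepi : ∀ θ, e (θ + Real.pi) = - e θ := by
    intro θ
    simp only [e]
    push_cast
    rw [add_mul, Complex.exp_add, Complex.exp_pi_mul_I]; ring
  have he2pi : ∀ θ, e (θ + 2 * Real.pi) = e θ := by
    intro θ
    have : θ + 2 * Real.pi = θ + Real.pi + Real.pi := by ring
    rw [this, hepi, hepi, neg_neg]
  let Φ : ℝ × ℝ → ℂ := fun x => G ((cl x.1 * R : ℝ) * e x.2) -
    ((1 - cl (x.1 - 1) : ℝ) * q + (cl (x.1 - 1) : ℝ) * G (-((cl (x.1 - 2) * R : ℝ) * e x.2)))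
  refine no_homotopy_const_odd Φ (by fun_prop) ?_ ?_ 3 ?_ ?_
  · rintro ⟨s, θ⟩ h
    simp only [Φ] at h
    have h := sub_eq_zero.1 h
    rcases le_or_gt s 1 with h1 | h1
    · have e1 : cl (s - 1) = 0 := by simp only [cl]; rw [min_eq_left (by linarith), max_eq_left (by linarith)]
      rw [e1] at h
      simp at h
      exact hq _ h
    · have e1 : cl s = 1 := by simp only [cl]; rw [min_eq_right (by linarith), max_eq_right (by linarith)]
      rcases le_or_gt s 2 with h2 | h2
      · have e2 : cl (s - 2) = 0 := by simp only [cl]; rw [min_eq_left (by linarith), max_eq_left (by linarith)]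
        have e3 : cl (s - 1) = s - 1 := by simp only [cl]; rw [min_eq_left (by linarith), max_eq_right (by linarith)]
        rw [e1, e2, e3] at h
        have h3 := hexp (((1 * R : ℝ) : ℂ) * e θ) 0
        rw [h] at h3
        have e4 : ((1 - (s - 1) : ℝ) : ℂ) * q + ((s - 1 : ℝ) : ℂ) * G (-(((0 * R : ℝ) : ℂ) * e θ)) - G 0
            = ((2 - s : ℝ) : ℂ) * (q - G 0) := by
          simp; ring
        rw [e4, norm_mul, sub_zero, norm_mul, hen, Complex.norm_real, Complex.norm_real, one_mul,
          Real.norm_of_nonneg hRpos.le, Real.norm_of_nonneg (by linarith), hR] at h3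
        field_simp at h3
        nlinarith [norm_nonneg (q - G 0)]
      · have e2 : cl (s - 1) = 1 := by simp only [cl]; rw [min_eq_right (by linarith), max_eq_right (by linarith)]
        rw [e1, e2] at h
        simp only [sub_self, Complex.ofReal_zero, zero_mul, Complex.ofReal_one, one_mul, zero_add] at h
        have h4 := hinj _ _ h
        have h5 : ((R + cl (s - 2) * R : ℝ) : ℂ) * e θ = 0 := by
          push_cast at h4 ⊢
          linear_combination h4
        have h6 : (0 : ℝ) ≤ cl (s - 2) := le_max_left _ _
        rcases mul_eq_zero.1 h5 with h7 | h7
        · have : R + cl (s - 2) * R = 0 := by exact_mod_cast h7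
          nlinarith [mul_nonneg h6 hRpos.le]
        · exact hene θ h7
  · intro s θ
    simp only [Φ, he2pi]
  · intro θ
    have e1 : cl 0 = 0 := by simp [cl]
    have e2 : cl (0 - 1) = 0 := by simp [cl]
    simp only [Φ, e1, e2]
    simp
  · intro θ
    have e1 : cl 3 = 1 := by norm_num [cl]
    have e2 : cl (3 - 1) = 1 := by norm_num [cl]
    have e3 : cl (3 - 2) = 1 := by norm_num [cl]
    simp only [Φ, e1, e2, e3, hepi]
    simp

/-- Coordinates adapted to the quadratic form `P`. -/
lemma exists_coords {E : Type*} [NormedAddCommGroup E] [NormedSpace ℝ E]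
    (P : E →L[ℝ] E →L[ℝ] ℝ) (Eplus Eminus : Submodule ℝ E)
    (hH1 : Semiflow.IsH1 P Eplus Eminus)
    [FiniteDimensional ℝ ↥Eminus] (hH2 : Module.finrank ℝ ↥Eminus = 2) :
    ∃ (ℓ : E →L[ℝ] ℂ) (m : ℂ →L[ℝ] E), (∀ z, P (m z) (m z) = -‖z‖ ^ 2) ∧
      (∀ x, -‖ℓ x‖ ^ 2 ≤ P x x) := by
  obtain ⟨hsym, -, -, hcompl, hpos, hneg⟩ := hH1
  let b := Module.finBasisOfFinrankEq ℝ Eminus hH2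
  have hb := b.linearIndependent
  have hpm : ∀ v ∈ Eminus, P v v ≤ 0 := by
    intro v hv
    by_cases h : v = 0
    · simp [h]
    · exact (hneg v hv h).le
  have hpp : ∀ v ∈ Eplus, 0 ≤ P v v := by
    intro v hv
    by_cases h : v = 0
    · simp [h]
    · exact (hpos v hv h).le
  -- orthonormal vectors
  obtain ⟨e1, e2, he1, he2, h11, h22, h12, hspan⟩ : ∃ e1 e2 : E, e1 ∈ Eminus ∧ e2 ∈ Eminus ∧
      P e1 e1 = -1 ∧ P e2 e2 = -1 ∧ P e1 e2 = 0 ∧ 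
      ∀ v ∈ Eminus, ∃ x y : ℝ, v = x • e1 + y • e2 := by
    set b0 : E := (b 0 : E) with hb0
    set b1 : E := (b 1 : E) with hb1
    have hb0m : b0 ∈ Eminus := (b 0).2
    have hb1m : b1 ∈ Eminus := (b 1).2
    have hb0ne : b0 ≠ 0 := by
      intro h
      exact hb.ne_zero 0 (Subtype.ext h)
    have hV0 := hneg b0 hb0m hb0ne
    set r : ℝ := P b0 b1 / P b0 b0 with hr
    set c1 : E := b1 - r • b0 with hc1
    have hc1m : c1 ∈ Eminus := Eminus.sub_mem hb1m (Eminus.smul_mem _ hb0m)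
    have hc1ne : c1 ≠ 0 := by
      intro h
      have h2 : (-r) • b 0 + (1 : ℝ) • b 1 = 0 := by
        apply Subtype.ext
        simp only [Submodule.coe_add, Submodule.coe_smul, Submodule.coe_zero]
        rw [← h, hc1]; module
      have h3 := Fintype.linearIndependent_iff.1 hb ![-r, 1] (by
        simpa [Fin.sum_univ_two] using h2) 1
      simp at h3
    have hV1 := hneg c1 hc1m hc1ne
    have horth : P b0 c1 = 0 := by
      rw [hc1, map_sub, map_smul, smul_eq_mul, hr]
      rw [div_mul_cancel₀ _ hV0.ne, sub_self]
    set a0 : ℝ := (Real.sqrt (-P b0 b0))⁻¹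
    set a1 : ℝ := (Real.sqrt (-P c1 c1))⁻¹
    have ha0 : a0 * a0 * P b0 b0 = -1 := by
      have := Real.mul_self_sqrt (show 0 ≤ -P b0 b0 by linarith)
      have h2 : Real.sqrt (-P b0 b0) ≠ 0 := (Real.sqrt_pos.2 (by linarith)).ne'
      simp only [a0]; field_simp; nlinarith
    have ha1 : a1 * a1 * P c1 c1 = -1 := by
      have := Real.mul_self_sqrt (show 0 ≤ -P c1 c1 by linarith)
      have h2 : Real.sqrt (-P c1 c1) ≠ 0 := (Real.sqrt_pos.2 (by linarith)).ne'
      simp only [a1]; field_simp; nlinarith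
    have ha0' : a0 ≠ 0 := by rintro h; rw [h] at ha0; norm_num at ha0
    have ha1' : a1 ≠ 0 := by rintro h; rw [h] at ha1; norm_num at ha1
    refine ⟨a0 • b0, a1 • c1, Eminus.smul_mem _ hb0m, Eminus.smul_mem _ hc1m, ?_, ?_, ?_, ?_⟩
    · simp only [map_smul, smul_apply, smul_eq_mul]; linarith
    · simp only [map_smul, smul_apply, smul_eq_mul]; linarith
    · simp [horth]
    · intro v hv
      have h := b.sum_repr ⟨v, hv⟩
      rw [Fin.sum_univ_two] at h
      have h := congrArg (Subtype.val) h
      simp only [Submodule.coe_add, Submodule.coe_smul] at h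
      set x := b.repr ⟨v, hv⟩ 0
      set y := b.repr ⟨v, hv⟩ 1
      refine ⟨(x + y * r) / a0, y / a1, ?_⟩
      rw [smul_smul, smul_smul, div_mul_cancel₀ _ ha0', div_mul_cancel₀ _ ha1', ← h, hc1]
      module
  have h21 : P e2 e1 = 0 := by rw [hsym, h12]
  let m : ℂ →L[ℝ] E := Complex.reCLM.smulRight e1 + Complex.imCLM.smulRight e2
  let ℓ : E →L[ℝ] ℂ := -(P e1).smulRight (1 : ℂ) - (P e2).smulRight Complex.I
  refine ⟨ℓ, m, ?_, ?_⟩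
  · intro z
    simp only [m, add_apply, ContinuousLinearMap.smulRight_apply,
      Complex.reCLM_apply, Complex.imCLM_apply, map_add, map_smul, smul_apply,
      h11, h12, h21, h22, smul_eq_mul]
    rw [← Complex.normSq_eq_norm_sq, Complex.normSq_apply]
    ring
  · intro x
    have hl : ‖ℓ x‖ ^ 2 = P e1 x ^ 2 + P e2 x ^ 2 := by
      rw [← Complex.normSq_eq_norm_sq, Complex.normSq_apply]
      simp [ℓ]
      ring
    set u : E := x + P e1 x • e1 + P e2 x • e2 with hu
    have hu1 : P e1 u = 0 := by simp [hu, h11, h12]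
    have hu2 : P e2 u = 0 := by simp [hu, h22, h21]
    have hVu : P u u = P x x + P e1 x ^ 2 + P e2 x ^ 2 := by
      have : P u u = P x u := by
        have hw : ∀ w, P u w = P x w + P e1 x * P e1 w + P e2 x * P e2 w := by
          intro w; rw [hu]; simp
        rw [hw u, hu1, hu2]; ring
      rw [this, hu]
      simp only [map_add, map_smul, smul_eq_mul]
      rw [hsym x e1, hsym x e2]; ring
    have hu0 : 0 ≤ P u u := by
      obtain ⟨p, hp, n, hn, hpn⟩ : ∃ p ∈ Eplus, ∃ n ∈ Eminus, p + n = u := by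
        have : u ∈ Eplus ⊔ Eminus := by rw [hcompl.sup_eq_top]; trivial
        exact Submodule.mem_sup.1 this
      obtain ⟨s, t, hst⟩ := hspan n hn
      have hnu : P n u = 0 := by rw [hst]; simp [hu1, hu2]
      have hpe : p = u - n := by rw [← hpn]; abel
      have h1 := hpp p hp
      have h2 := hpm n hn
      rw [hpe] at h1
      simp only [map_sub, sub_apply] at h1
      rw [hsym u n, hnu] at h1
      linarith
    rw [hl]; linarith

namespace Semiflow

section Aux

variable {E : Type*} [NormedAddCommGroup E] [NormedSpace ℝ E]
variable {H : Type*} [NormedAddCommGroup H] [InnerProductSpace ℝ H]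

lemma continuous_ext (φ : Semiflow E) :
    Continuous (fun p : ℝ × E => φ.toFun (max p.1 0) p.2) := by
  have h := φ.continuousOn'.comp_continuous (f := fun p : ℝ × E => (max p.1 0, p.2))
    (by fun_prop) (fun p => Set.mk_mem_prod (mem_Ici.2 (le_max_right _ _)) (mem_univ _))
  exact h

lemma continuous_space (φ : Semiflow E) {t : ℝ} (ht : 0 ≤ t) : Continuous (φ.toFun t) := by
  have h : Continuous (fun v : E => φ.toFun (max t 0) v) :=
    φ.continuous_ext.comp (by fun_prop : Continuous (fun v : E => (t, v)))
  rwa [max_eq_left ht] at h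

lemma continuousOn_time (φ : Semiflow E) (v : E) :
    ContinuousOn (fun t => φ.toFun t v) (Ici 0) := by
  have h : Continuous (fun t : ℝ => φ.toFun (max t 0) v) :=
    φ.continuous_ext.comp (by fun_prop : Continuous (fun t : ℝ => (t, v)))
  refine h.continuousOn.congr (fun t ht => ?_)
  simp only [max_eq_left (show (0 : ℝ) ≤ t from ht)]

/-- Uniform continuity on bounded time intervals near a compact set. -/
lemma unif_near_compact (φ : Semiflow E) {K : Set E} (hK : IsCompact K) (τ ε : ℝ) (hε : 0 < ε) :
    ∃ κ : ℝ, 0 < κ ∧ ∀ p ∈ K, ∀ t, 0 ≤ t → t ≤ τ → ∀ w, ‖w - p‖ < κ →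
      ‖φ.toFun t w - φ.toFun t p‖ < ε := by
  have hc : IsCompact (Icc (0 : ℝ) τ ×ˢ K) := isCompact_Icc.prod hK
  have h := hc.uniformContinuousAt_of_continuousAt _
    (fun a _ => φ.continuous_ext.continuousAt) (Metric.dist_mem_uniformity hε)
  obtain ⟨κ, hκ, h⟩ := Metric.mem_uniformity_dist.1 h
  refine ⟨κ, hκ, fun p hp t ht htτ w hw => ?_⟩
  have h1 := @h (t, p) (t, w) (by
    rw [Prod.dist_eq]; simp only [dist_self]
    rw [max_eq_right dist_nonneg, dist_comm, dist_eq_norm]; exact hw)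
  have h2 := h1 ⟨⟨ht, htτ⟩, hp⟩
  simp only [max_eq_left ht] at h2
  rw [← dist_eq_norm, dist_comm]
  exact h2

/-- Monotonicity of `e^{2νt} V`. -/
lemma mono_of_H3 {φ : Semiflow E} {ι : E →L[ℝ] H} {P : E →L[ℝ] E →L[ℝ] ℝ} {δ τV ν : ℝ}
    (hH3 : φ.IsH3 ι P δ τV ν) (v₁ v₂ : E) (T : ℝ) (hT : τV ≤ T) :
    Real.exp (2 * ν * T) * P (φ.toFun T v₁ - φ.toFun T v₂) (φ.toFun T v₁ - φ.toFun T v₂)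
      + δ * (∫ s in (0 : ℝ)..T, Real.exp (2 * ν * s) *
          ‖ι (φ.toFun s v₁) - ι (φ.toFun s v₂)‖ ^ 2) ≤ P (v₁ - v₂) (v₁ - v₂) := by
  obtain ⟨hδ, hτ, hν, h⟩ := hH3
  have h1 := h v₁ v₂ 0 T le_rfl (by linarith) (by linarith)
  simp only [mul_zero, Real.exp_zero, one_mul, φ.map_zero'] at h1
  linarith

lemma key_estimate {φ : Semiflow E} {ι : E →L[ℝ] H} {P : E →L[ℝ] E →L[ℝ] ℝ} {δ τV ν : ℝ}
    (hH3 : φ.IsH3 ι P δ τV ν) {τS C : ℝ} (hτS : 0 ≤ τS) (hC : 0 < C)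
    (hS : ∀ v₁ v₂ : E, ‖φ.toFun τS v₁ - φ.toFun τS v₂‖ ≤ C * ‖ι v₁ - ι v₂‖) :
    ∃ c : ℝ, 0 < c ∧ ∀ v₁ v₂ : E, ∀ T a : ℝ, τV ≤ T → 0 ≤ a → a + 1 ≤ T →
      ∃ s ∈ Icc (a + τS) (a + τS + 1),
        Real.exp (2 * ν * T) * P (φ.toFun T v₁ - φ.toFun T v₂) (φ.toFun T v₁ - φ.toFun T v₂)
          + c * (Real.exp (2 * ν * a) * ‖φ.toFun s v₁ - φ.toFun s v₂‖ ^ 2)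
          ≤ P (v₁ - v₂) (v₁ - v₂) := by
  have hδ := hH3.1
  have hν := hH3.2.2.1
  refine ⟨δ / C ^ 2, by positivity, fun v₁ v₂ T a hT ha haT => ?_⟩
  have hm := mono_of_H3 hH3 v₁ v₂ T hT
  set f : ℝ → ℝ := fun s => ‖ι (φ.toFun s v₁) - ι (φ.toFun s v₂)‖ ^ 2 with hf
  have hfc : ContinuousOn f (Ici 0) :=
    ((ι.continuous.comp_continuousOn (φ.continuousOn_time v₁)).sub
      (ι.continuous.comp_continuousOn (φ.continuousOn_time v₂))).norm.pow 2
  have hf0 : ∀ s, 0 ≤ f s := fun s => by positivity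
  have hgc : ContinuousOn (fun s => Real.exp (2 * ν * s) * f s) (Ici 0) :=
    (by fun_prop : Continuous fun s => Real.exp (2 * ν * s)).continuousOn.mul hfc
  obtain ⟨s₀, hs₀, hmin⟩ := isCompact_Icc.exists_isMinOn (nonempty_Icc.2 (by linarith : a ≤ a + 1))
    (hfc.mono (fun x hx => le_trans ha hx.1))
  have hint : ∀ x y, 0 ≤ x → x ≤ y → IntervalIntegrable (fun s => Real.exp (2 * ν * s) * f s)
      volume x y := fun x y hx hxy => (hgc.mono (by
        rw [uIcc_of_le hxy]; exact fun z hz => le_trans hx hz.1)).intervalIntegrable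
  have h1 : ∫ s in a..(a + 1), Real.exp (2 * ν * s) * f s ≤
      ∫ s in (0 : ℝ)..T, Real.exp (2 * ν * s) * f s :=
    intervalIntegral.integral_mono_interval ha (by linarith) haT
      (Eventually.of_forall fun s => mul_nonneg (Real.exp_pos _).le (hf0 s))
      (hint 0 T le_rfl (by linarith))
  have h2 : Real.exp (2 * ν * a) * f s₀ ≤ ∫ s in a..(a + 1), Real.exp (2 * ν * s) * f s := by
    have : ∫ s in a..(a + 1), Real.exp (2 * ν * a) * f s₀ = Real.exp (2 * ν * a) * f s₀ := by
      simp
    rw [← this]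
    refine intervalIntegral.integral_mono_on (by linarith) (by simp) (hint _ _ ha (by linarith)) ?_
    intro x hx
    refine mul_le_mul (Real.exp_le_exp.2 ?_) (hmin hx) (hf0 _) (Real.exp_pos _).le
    have := hx.1
    nlinarith
  refine ⟨s₀ + τS, ⟨by linarith [hs₀.1], by linarith [hs₀.2]⟩, ?_⟩
  have hs0 : 0 ≤ s₀ := le_trans ha hs₀.1
  have h3 := hS (φ.toFun s₀ v₁) (φ.toFun s₀ v₂)
  rw [← φ.map_add' _ _ hτS hs0, ← φ.map_add' _ _ hτS hs0, add_comm τS s₀] at h3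
  have h4 : ‖φ.toFun (s₀ + τS) v₁ - φ.toFun (s₀ + τS) v₂‖ ^ 2 ≤ C ^ 2 * f s₀ := by
    rw [hf, ← mul_pow]
    exact pow_le_pow_left₀ (norm_nonneg _) h3 2
  have h5 : δ / C ^ 2 * (Real.exp (2 * ν * a) *
      ‖φ.toFun (s₀ + τS) v₁ - φ.toFun (s₀ + τS) v₂‖ ^ 2) ≤ δ * (Real.exp (2 * ν * a) * f s₀) := by
    have e : δ * (Real.exp (2 * ν * a) * f s₀) =
      δ / C ^ 2 * (Real.exp (2 * ν * a) * (C ^ 2 * f s₀)) := by field_simp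
    rw [e]
    gcongr
  have h6 := mul_le_mul_of_nonneg_left (h2.trans h1) hδ.le
  linarith

lemma quad_le (P : E →L[ℝ] E →L[ℝ] ℝ) (x y : E) : |P x y| ≤ ‖P‖ * ‖x‖ * ‖y‖ := by
  simpa using P.le_opNorm₂ x y

lemma traj_eq {φ : Semiflow E} {u : ℝ → E} (hu : φ.IsCompleteTrajectory u) {l r : ℝ} (h : l ≤ r) :
    u r = φ.toFun (r - l) (u l) := by
  rw [← hu.2 (r - l) (by linarith) l]; congr 1; ring

/-- Time shifts of amenable trajectories are amenable. -/
lemma amenable_shift {φ : Semiflow E} {ι : E →L[ℝ] H} {ν : ℝ} {u : ℝ → E}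
    (hu : φ.IsAmenableTrajectory ι ν u) (T : ℝ) :
    φ.IsAmenableTrajectory ι ν (fun s => u (s + T)) := by
  obtain ⟨⟨hc, ht⟩, hi⟩ := hu
  refine ⟨⟨by fun_prop, fun t h s => ?_⟩, ?_⟩
  · rw [← ht t h]; congr 1; ring
  · set g : ℝ → ℝ := fun s => Real.exp (2 * ν * s) * ‖ι (u s)‖ ^ 2 with hg
    have hgc : Continuous g := by fun_prop
    have h1 : IntegrableOn g (Iic T) := by
      have h2 : IntegrableOn g (Icc 0 T) := hgc.continuousOn.integrableOn_Icc
      refine (hi.union h2).mono_set (fun x hx => ?_)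
      rcases le_total x 0 with h | h
      · exact Or.inl h
      · exact Or.inr ⟨h, hx⟩
    have h3 : IntegrableOn (fun s => g (s + T)) (Iic 0) := by
      have := (measurePreserving_add_right volume T).integrableOn_comp_preimage
        (Homeomorph.addRight T).measurableEmbedding (f := g) (s := Iic T)
      have h4 := this.2 h1
      have e : (fun x => x + T) ⁻¹' Iic T = Iic (0 : ℝ) := by
        ext x; simp
      rw [e] at h4
      exact h4
    have h5 : IntegrableOn (fun s => Real.exp (-(2 * ν * T)) * g (s + T)) (Iic 0) :=
      h3.const_mul (Real.exp (-(2 * ν * T)))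
    refine h5.congr_fun (fun s _ => ?_) measurableSet_Iic
    simp only [hg]
    rw [← mul_assoc, ← Real.exp_add]
    congr 2; ring

/-- The quadratic form is nonpositive on differences of amenable trajectories. -/
lemma pair_nonpos {φ : Semiflow E} {ι : E →L[ℝ] H} {P : E →L[ℝ] E →L[ℝ] ℝ} {δ τV ν : ℝ}
    (hH3 : φ.IsH3 ι P δ τV ν) {τS C : ℝ} (hτS : 0 ≤ τS) (hC : 0 < C)
    (hS : ∀ v₁ v₂ : E, ‖φ.toFun τS v₁ - φ.toFun τS v₂‖ ≤ C * ‖ι v₁ - ι v₂‖)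
    {u w : ℝ → E} (hu : φ.IsAmenableTrajectory ι ν u) (hw : φ.IsAmenableTrajectory ι ν w) (r : ℝ) :
    P (u r - w r) (u r - w r) ≤ 0 := by
  have hδ := hH3.1
  have hτV := hH3.2.1
  set g : ℝ → ℝ := fun s => Real.exp (2 * ν * s) * ‖ι (u s) - ι (w s)‖ ^ 2 with hg
  have hucont := hu.1.1
  have hwcont := hw.1.1
  have hgi : IntegrableOn g (Iic 0) := by
    refine ((hu.2.add hw.2).const_mul 2).mono' ?_ ?_
    · exact (by fun_prop : Continuous g).aestronglyMeasurable
    · refine Eventually.of_forall fun s => ?_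
      rw [Real.norm_of_nonneg (by positivity)]
      simp only [hg, Pi.add_apply]
      have h1 : ‖ι (u s) - ι (w s)‖ ^ 2 ≤ 2 * (‖ι (u s)‖ ^ 2 + ‖ι (w s)‖ ^ 2) := by
        have := norm_sub_le (ι (u s)) (ι (w s))
        nlinarith [norm_nonneg (ι (u s) - ι (w s)), sq_nonneg (‖ι (u s)‖ - ‖ι (w s)‖)]
      have := mul_le_mul_of_nonneg_left h1 (Real.exp_pos (2 * ν * s)).le
      linarith
  -- arbitrarily negative times with small weighted difference
  have hsmall : ∀ η > 0, ∀ L ≤ (0 : ℝ), ∃ l ≤ L, g l ≤ η := by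
    intro η hη L hL
    by_contra hcon
    push Not at hcon
    have h1 : IntegrableOn (fun _ : ℝ => η) (Iic L) := by
      refine (hgi.mono_set (Iic_subset_Iic.2 hL)).mono' aestronglyMeasurable_const ?_
      rw [ae_restrict_iff' measurableSet_Iic]
      exact Eventually.of_forall fun s hs => by
        rw [Real.norm_of_nonneg hη.le]; exact (hcon s hs).le
    rw [integrableOn_const_iff] at h1
    rcases h1 with h | h
    · exact hη.ne' (by simpa using h)
    · simp at h
  have hb : ∀ η > 0, P (u r - w r) (u r - w r) ≤ ‖P‖ * C ^ 2 * Real.exp (2 * ν * (τS - r)) * η := by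
    intro η hη
    obtain ⟨l, hl, hgl⟩ := hsmall η hη (min 0 (r - τV - τS)) (min_le_left _ _)
    have hl2 : l ≤ r - τV - τS := hl.trans (min_le_right _ _)
    have h1 := hS (u l) (w l)
    rw [← hu.1.2 τS hτS l, ← hw.1.2 τS hτS l] at h1
    set l' := τS + l
    have h2 : P (u l' - w l') (u l' - w l') ≤ ‖P‖ * (C ^ 2 * ‖ι (u l) - ι (w l)‖ ^ 2) := by
      calc _ ≤ ‖P‖ * ‖u l' - w l'‖ * ‖u l' - w l'‖ := (le_abs_self _).trans (quad_le _ _ _)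
        _ = ‖P‖ * ‖u l' - w l'‖ ^ 2 := by ring
        _ ≤ _ := by rw [← mul_pow]; gcongr
    have hl'r : l' ≤ r := by simp only [l']; linarith
    have h3 := mono_of_H3 hH3 (u l') (w l') (r - l') (by simp only [l']; linarith)
    rw [← traj_eq hu.1 hl'r, ← traj_eq hw.1 hl'r] at h3
    have h4 : 0 ≤ ∫ s in (0 : ℝ)..(r - l'), Real.exp (2 * ν * s) *
          ‖ι (φ.toFun s (u l')) - ι (φ.toFun s (w l'))‖ ^ 2 :=
      intervalIntegral.integral_nonneg (by linarith) (fun s _ => by positivity)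
    have h5 := mul_nonneg hδ.le h4
    have h6 : Real.exp (2 * ν * (r - l')) * P (u r - w r) (u r - w r) ≤
        ‖P‖ * (C ^ 2 * ‖ι (u l) - ι (w l)‖ ^ 2) := by linarith
    have h7 : P (u r - w r) (u r - w r) =
        Real.exp (-(2 * ν * (r - l'))) * (Real.exp (2 * ν * (r - l')) * P (u r - w r) (u r - w r)) := by
      rw [← mul_assoc, ← Real.exp_add]; simp
    rw [h7]
    calc _ ≤ Real.exp (-(2 * ν * (r - l'))) * (‖P‖ * (C ^ 2 * ‖ι (u l) - ι (w l)‖ ^ 2)) := by gcongr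
      _ = ‖P‖ * C ^ 2 * Real.exp (2 * ν * (τS - r)) * g l := by
        have : Real.exp (-(2 * ν * (r - l'))) = Real.exp (2 * ν * (τS - r)) * Real.exp (2 * ν * l) := by
          rw [← Real.exp_add]; congr 1; simp only [l']; ring
        rw [this]; simp only [hg]; ring
      _ ≤ _ := by gcongr
  set A := ‖P‖ * C ^ 2 * Real.exp (2 * ν * (τS - r))
  have hA : 0 ≤ A := by positivity
  refine le_of_forall_pos_le_add fun ε hε => ?_
  have := hb (ε / (A + 1)) (by positivity)
  refine this.trans ?_
  rw [zero_add, ← mul_div_assoc, div_le_iff₀ (by positivity)]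
  nlinarith

/-- Closeness of amenable trajectories in the past, in terms of the quadratic form. -/
lemma pair_key {φ : Semiflow E} {ι : E →L[ℝ] H} {P : E →L[ℝ] E →L[ℝ] ℝ} {δ τV ν : ℝ}
    (hH3 : φ.IsH3 ι P δ τV ν) {τS C : ℝ} (hτS : 0 ≤ τS) (hC : 0 < C)
    (hS : ∀ v₁ v₂ : E, ‖φ.toFun τS v₁ - φ.toFun τS v₂‖ ≤ C * ‖ι v₁ - ι v₂‖) :
    ∃ D : ℝ, 0 < D ∧ ∀ u w : ℝ → E, φ.IsAmenableTrajectory ι ν u →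
      φ.IsAmenableTrajectory ι ν w → ∀ t r, t ≤ r → ∃ s ∈ Icc (t - 1) t,
        ‖u s - w s‖ ^ 2 ≤ D * Real.exp (2 * ν * (r - t)) * (-P (u r - w r) (u r - w r)) := by
  obtain ⟨c, hc, hkey⟩ := key_estimate hH3 hτS hC hS
  have hτV := hH3.2.1
  refine ⟨Real.exp (2 * ν * (1 + τS)) / c, by positivity, fun u w hu hw t r htr => ?_⟩
  set a := τV + 1 with ha
  set l := t - 1 - τS - a with hl
  obtain ⟨s, hs, hks⟩ := hkey (u l) (w l) (r - l) a (by linarith) (by linarith) (by linarith)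
  have hs0 : 0 ≤ s := by linarith [hs.1]
  rw [← traj_eq hu.1 (by linarith : l ≤ r), ← traj_eq hw.1 (by linarith : l ≤ r),
    ← hu.1.2 s hs0 l, ← hw.1.2 s hs0 l] at hks
  have h0 := pair_nonpos hH3 hτS hC hS hu hw l
  refine ⟨s + l, ⟨by linarith [hs.1], by linarith [hs.2]⟩, ?_⟩
  set X := ‖u (s + l) - w (s + l)‖ ^ 2
  set Y := P (u r - w r) (u r - w r)
  have h1 : c * (Real.exp (2 * ν * a) * X) ≤ Real.exp (2 * ν * (r - l)) * (-Y) := by linarith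
  have e1 : Real.exp (2 * ν * (r - l)) =
      Real.exp (2 * ν * a) * (Real.exp (2 * ν * (1 + τS)) * Real.exp (2 * ν * (r - t))) := by
    rw [← Real.exp_add, ← Real.exp_add]; congr 1; simp only [hl]; ring
  rw [e1] at h1
  have h2 : Real.exp (2 * ν * a) * (c * X) ≤ Real.exp (2 * ν * a) *
      (Real.exp (2 * ν * (1 + τS)) * Real.exp (2 * ν * (r - t)) * (-Y)) := by linarith
  have h3 := le_of_mul_le_mul_left h2 (Real.exp_pos _)
  rw [div_mul_eq_mul_div, div_mul_eq_mul_div, le_div_iff₀ hc]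
  linarith

/-- The amenable set is a graph over the whole plane: surjectivity. -/
lemma exists_amenable_over {φ : Semiflow E} {ι : E →L[ℝ] H} {P : E →L[ℝ] E →L[ℝ] ℝ} {δ τV ν : ℝ}
    (hH3 : φ.IsH3 ι P δ τV ν) {τS C : ℝ} (hτS : 0 ≤ τS) (hC : 0 < C)
    (hS : ∀ v₁ v₂ : E, ‖φ.toFun τS v₁ - φ.toFun τS v₂‖ ≤ C * ‖ι v₁ - ι v₂‖)
    (hCOM : φ.IsCOM) (ℓ : E →L[ℝ] ℂ) (m : ℂ →L[ℝ] E) (hm : ∀ z, P (m z) (m z) = -‖z‖ ^ 2)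
    (hℓ : ∀ x, -‖ℓ x‖ ^ 2 ≤ P x x)
    {v : ℝ → E} (hv : φ.IsAmenableTrajectory ι ν v) (z : ℂ) :
    ∃ u : ℝ → E, φ.IsAmenableTrajectory ι ν u ∧ ℓ (u 0) = z := by
  have hδ := hH3.1
  have hτV := hH3.2.1
  have hν := hH3.2.2.1
  obtain ⟨c, hc, hkey⟩ := key_estimate hH3 hτS hC hS
  obtain ⟨τc, hτc, hcom⟩ := hCOM
  have hvcont := hv.1.1
  have hmono : ∀ v₁ v₂ : E, ∀ T, τV ≤ T → Real.exp (2 * ν * T) *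
      P (φ.toFun T v₁ - φ.toFun T v₂) (φ.toFun T v₁ - φ.toFun T v₂) ≤ P (v₁ - v₂) (v₁ - v₂) := by
    intro v₁ v₂ T hT
    have h1 := mono_of_H3 hH3 v₁ v₂ T hT
    have h4 : 0 ≤ ∫ s in (0 : ℝ)..T, Real.exp (2 * ν * s) *
          ‖ι (φ.toFun s v₁) - ι (φ.toFun s v₂)‖ ^ 2 :=
      intervalIntegral.integral_nonneg (by linarith) (fun s _ => by positivity)
    have := mul_nonneg hδ.le h4
    linarith
  -- shooting
  have hshoot : ∀ T, τV ≤ T → ∃ y : ℂ, ℓ (φ.toFun T (v (-T) + m y)) = z := by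
    intro T hT
    have hT0 : 0 ≤ T := hτV.trans hT
    have hcs := φ.continuous_space hT0
    refine surjective_of_expansive (fun y => ℓ (φ.toFun T (v (-T) + m y))) (by fun_prop)
      (Real.exp (-(ν * T))) (Real.exp_pos _) ?_ z
    intro y y'
    have h1 := hmono (v (-T) + m y) (v (-T) + m y') T hT
    have e1 : v (-T) + m y - (v (-T) + m y') = m (y - y') := by rw [map_sub]; abel
    rw [e1, hm] at h1
    have h2 := hℓ (φ.toFun T (v (-T) + m y) - φ.toFun T (v (-T) + m y'))
    rw [map_sub] at h2
    set X := ‖ℓ (φ.toFun T (v (-T) + m y)) - ℓ (φ.toFun T (v (-T) + m y'))‖ with hX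
    have h3 : ‖y - y'‖ ^ 2 ≤ Real.exp (2 * ν * T) * X ^ 2 := by
      have := mul_le_mul_of_nonneg_left h2 (Real.exp_pos (2 * ν * T)).le
      linarith
    refine le_of_sq_le_sq ?_ (norm_nonneg _)
    have e2 : Real.exp (2 * ν * T) = Real.exp (ν * T) ^ 2 := by
      rw [← Real.exp_nat_mul]; congr 1; push_cast; ring
    have e3 : Real.exp (-(ν * T)) * Real.exp (ν * T) = 1 := by
      rw [← Real.exp_add]; simp
    calc (Real.exp (-(ν * T)) * ‖y - y'‖) ^ 2 = Real.exp (-(ν * T)) ^ 2 * ‖y - y'‖ ^ 2 := by ring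
      _ ≤ Real.exp (-(ν * T)) ^ 2 * (Real.exp (2 * ν * T) * X ^ 2) := by gcongr
      _ = (Real.exp (-(ν * T)) * Real.exp (ν * T)) ^ 2 * X ^ 2 := by rw [e2]; ring
      _ = X ^ 2 := by rw [e3]; ring
  set N : ℕ → ℝ := fun n => n + τV with hN
  have hNτ : ∀ n, τV ≤ N n := fun n => by simp [hN]
  have hN0 : ∀ n, 0 ≤ N n := fun n => hτV.trans (hNτ n)
  choose zf hzf using fun n => hshoot (N n) (hNτ n)
  set x : ℕ → E := fun n => v (-N n) + m (zf n) with hx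
  have hVx : ∀ n, P (x n - v (-N n)) (x n - v (-N n)) ≤ 0 := by
    intro n
    have : x n - v (-N n) = m (zf n) := by simp [hx]
    rw [this, hm]; nlinarith [sq_nonneg ‖zf n‖]
  have hvt : ∀ n s, 0 ≤ N n + s → φ.toFun (N n + s) (v (-N n)) = v s := by
    intro n s h
    rw [← hv.1.2 _ h]; congr 1; ring
  have hlarge : ∀ A : ℝ, ∀ᶠ n in (hyperfilter ℕ : Filter ℕ), A ≤ N n := by
    intro A
    have h1 : ∀ᶠ n : ℕ in atTop, A ≤ N n :=
      (tendsto_atTop_add_const_right _ τV tendsto_natCast_atTop_atTop).eventually_ge_atTop A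
    exact Nat.hyperfilter_le_atTop h1
  set M : ℝ := ‖z - ℓ (v 0)‖ ^ 2 with hM
  -- negativity
  have hneg : ∀ s, ∀ᶠ n in (hyperfilter ℕ : Filter ℕ),
      P (φ.toFun (N n + s) (x n) - v s) (φ.toFun (N n + s) (x n) - v s) ≤ 0 := by
    intro s
    filter_upwards [hlarge (τV - s)] with n hn
    have h1 := hmono (x n) (v (-N n)) (N n + s) (by linarith)
    rw [hvt n s (by linarith)] at h1
    have h2 := h1.trans (hVx n)
    by_contra hcon
    push Not at hcon
    have := mul_pos (Real.exp_pos (2 * ν * (N n + s))) hcon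
    linarith
  set τ := τS + 1 + τc with hτ
  -- compactness
  have hcompact : ∀ j : ℕ, 1 ≤ j → ∃ K : Set E, IsCompact K ∧
      ∀ᶠ n in (hyperfilter ℕ : Filter ℕ), φ.toFun (N n + (-j + τ)) (x n) ∈ K := by
    intro j hj
    have hj' : (1 : ℝ) ≤ j := by exact_mod_cast hj
    obtain ⟨B, hB⟩ := (isCompact_Icc (a := -(j : ℝ) + τS) (b := -j + τS + 1)).exists_bound_of_continuousOn
      hvcont.continuousOn
    set R : ℝ := Real.sqrt (Real.exp (2 * ν * j) * M / c) + B with hR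
    have hK1 := hcom (Metric.closedBall 0 R) Metric.isBounded_closedBall
    refine ⟨_, ((isCompact_Icc (a := (0 : ℝ)) (b := 1)).prod hK1).image φ.continuous_ext, ?_⟩
    filter_upwards [hlarge j] with n hn
    obtain ⟨s, hs, hks⟩ := hkey (x n) (v (-N n)) (N n) (N n - j) (hNτ n) (by linarith) (by linarith)
    have hs0 : 0 ≤ s := by linarith [hs.1]
    have e0 : φ.toFun (N n) (v (-N n)) = v 0 := by
      have := hvt n 0 (by linarith [hN0 n])
      rwa [add_zero] at this
    have e1 : φ.toFun s (v (-N n)) = v (s - N n) := by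
      have := hvt n (s - N n) (by linarith)
      rwa [add_sub_cancel] at this
    rw [e0, e1] at hks
    have h2 := hℓ (φ.toFun (N n) (x n) - v 0)
    rw [map_sub, hzf n, ← hM] at h2
    set Y := ‖φ.toFun s (x n) - v (s - N n)‖ with hY
    have h3 : c * (Real.exp (2 * ν * (N n - j)) * Y ^ 2) ≤ Real.exp (2 * ν * N n) * M := by
      have := mul_le_mul_of_nonneg_left h2 (Real.exp_pos (2 * ν * N n)).le
      have := hVx n
      linarith
    have e2 : Real.exp (2 * ν * N n) = Real.exp (2 * ν * (N n - j)) * Real.exp (2 * ν * j) := by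
      rw [← Real.exp_add]; congr 1; ring
    have h4 : Y ^ 2 ≤ Real.exp (2 * ν * j) * M / c := by
      rw [le_div_iff₀ hc]
      rw [e2] at h3
      refine le_of_mul_le_mul_left ?_ (Real.exp_pos (2 * ν * (N n - j)))
      linarith
    have h5 : Y ≤ Real.sqrt (Real.exp (2 * ν * j) * M / c) := Real.le_sqrt_of_sq_le h4
    have h6 := hB (s - N n) ⟨by linarith [hs.1], by linarith [hs.2]⟩
    have h7 : φ.toFun s (x n) ∈ Metric.closedBall (0 : E) R := by
      rw [mem_closedBall_zero_iff]
      have := norm_le_norm_sub_add (φ.toFun s (x n)) (v (s - N n))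
      linarith
    refine ⟨(N n + (-j + τ) - τc - s, φ.toFun τc (φ.toFun s (x n))),
      Set.mk_mem_prod ⟨by linarith [hs.2], by linarith [hs.1]⟩
        (subset_closure (mem_image_of_mem _ h7)), ?_⟩
    have h8 : 0 ≤ N n + (-j + τ) - τc - s := by linarith [hs.2]
    simp only [max_eq_left h8]
    rw [← φ.map_add' _ _ hτc.le hs0, ← φ.map_add' _ _ h8 (by linarith)]
    congr 1; ring
  -- pointwise limits along the ultrafilter
  have hlim : ∀ s : ℝ, ∃ y : E, Tendsto (fun n => φ.toFun (N n + s) (x n))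
      (hyperfilter ℕ : Filter ℕ) (𝓝 y) := by
    intro s
    obtain ⟨j, hj⟩ := exists_nat_ge (max 1 (τ - s))
    have hj1 : 1 ≤ j := by exact_mod_cast (le_max_left _ _).trans hj
    have hj2 : τ - s ≤ j := (le_max_right _ _).trans hj
    obtain ⟨K, hK, hKn⟩ := hcompact j hj1
    obtain ⟨y, -, hy⟩ := hK.ultrafilter_le_nhds
      ((hyperfilter ℕ).map (fun n => φ.toFun (N n + (-j + τ)) (x n))) (by
        rw [le_principal_iff]; exact hKn)
    have hy' : Tendsto (fun n => φ.toFun (N n + (-j + τ)) (x n)) (hyperfilter ℕ : Filter ℕ) (𝓝 y) :=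
      hy
    have h0 : 0 ≤ s - (-j + τ) := by linarith
    refine ⟨φ.toFun (s - (-j + τ)) y, ?_⟩
    refine (((φ.continuous_space h0).tendsto y).comp hy').congr' ?_
    filter_upwards [hlarge (j - τ)] with n hn
    simp only [Function.comp]
    rw [← φ.map_add' _ _ h0 (by linarith)]
    congr 1; ring
  choose u hu using hlim
  have hut : ∀ t, 0 ≤ t → ∀ s, u (t + s) = φ.toFun t (u s) := by
    intro t ht s
    refine tendsto_nhds_unique (hu (t + s)) ?_
    refine (((φ.continuous_space ht).tendsto (u s)).comp (hu s)).congr' ?_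
    filter_upwards [hlarge (-s)] with n hn
    simp only [Function.comp]
    rw [← φ.map_add' _ _ ht (by linarith)]
    congr 1; ring
  have huc : Continuous u := by
    rw [continuous_iff_continuousAt]
    intro s
    have h1 : Continuous (fun r : ℝ => φ.toFun (max (r - (s - 1)) 0) (u (s - 1))) :=
      φ.continuous_ext.comp (by fun_prop : Continuous (fun r : ℝ => (r - (s - 1), u (s - 1))))
    refine h1.continuousAt.congr ?_
    filter_upwards [Ioi_mem_nhds (show s - 1 < s by linarith)] with r hr
    have hr' : 0 ≤ r - (s - 1) := by linarith [mem_Ioi.1 hr]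
    rw [max_eq_left hr', ← hut _ hr']
    congr 1; ring
  have hutraj : φ.IsCompleteTrajectory u := ⟨huc, hut⟩
  have hVu : ∀ s, P (u s - v s) (u s - v s) ≤ 0 := by
    intro s
    have hcq : Continuous (fun y : E => P (y - v s) (y - v s)) := by fun_prop
    exact le_of_tendsto ((hcq.tendsto (u s)).comp (hu s)) (hneg s)
  have hu0 : ℓ (u 0) = z := by
    refine tendsto_nhds_unique ((ℓ.continuous.tendsto _).comp (hu 0)) ?_
    refine tendsto_const_nhds.congr (fun n => ?_)
    simp only [Function.comp, add_zero]
    exact (hzf n).symm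
  refine ⟨u, ⟨hutraj, ?_⟩, hu0⟩
  -- amenability
  set f : ℝ → ℝ := fun s => ‖ι (u s) - ι (v s)‖ ^ 2 with hf
  have hbound : ∀ l, l ≤ -τV → ∫ s in l..0, Real.exp (2 * ν * s) * f s ≤ M / δ := by
    intro l hl
    have h1 := mono_of_H3 hH3 (u l) (v l) (-l) (by linarith)
    have e1 : φ.toFun (-l) (u l) = u 0 := by
      rw [← hut _ (by linarith)]; simp
    have e2 : φ.toFun (-l) (v l) = v 0 := by
      rw [← hv.1.2 _ (by linarith)]; simp
    have e3 : ∫ s in (0 : ℝ)..(-l), Real.exp (2 * ν * s) *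
          ‖ι (φ.toFun s (u l)) - ι (φ.toFun s (v l))‖ ^ 2 =
        Real.exp (-(2 * ν * l)) * ∫ s in l..0, Real.exp (2 * ν * s) * f s := by
      rw [← intervalIntegral.integral_const_mul]
      have := intervalIntegral.integral_comp_add_right (a := 0) (b := -l)
        (fun s => Real.exp (-(2 * ν * l)) * (Real.exp (2 * ν * s) * f s)) l
      rw [zero_add, neg_add_cancel] at this
      rw [← this]
      refine intervalIntegral.integral_congr (fun s hs => ?_)
      rw [uIcc_of_le (by linarith)] at hs
      simp only [hf]
      rw [hut s hs.1, hv.1.2 s hs.1, ← mul_assoc, ← Real.exp_add]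
      congr 2; ring
    rw [e1, e2, e3] at h1
    have h2 := hℓ (u 0 - v 0)
    rw [map_sub, hu0, ← hM] at h2
    have h3 := hVu l
    have e4 : Real.exp (2 * ν * -l) = Real.exp (-(2 * ν * l)) := by congr 1; ring
    rw [e4] at h1
    set X := ∫ s in l..0, Real.exp (2 * ν * s) * f s
    have h4 := mul_le_mul_of_nonneg_left h2 (Real.exp_pos (-(2 * ν * l))).le
    rw [le_div_iff₀ hδ]
    refine le_of_mul_le_mul_left ?_ (Real.exp_pos (-(2 * ν * l)))
    linarith
  have hgc : Continuous (fun s => Real.exp (2 * ν * s) * f s) := by fun_prop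
  have hgi : IntegrableOn (fun s => Real.exp (2 * ν * s) * f s) (Iic 0) := by
    refine integrableOn_Iic_of_intervalIntegral_norm_bounded (M / δ) 0 (a := id) (l := atBot)
      (fun i => (hgc.integrableOn_Ioc)) tendsto_id ?_
    filter_upwards [eventually_le_atBot (-τV)] with l hl
    refine le_trans (le_of_eq ?_) (hbound l hl)
    refine intervalIntegral.integral_congr (fun s _ => ?_)
    exact Real.norm_of_nonneg (by positivity)
  refine ((hgi.add hv.2).const_mul 2).mono' ?_ ?_
  · exact (by fun_prop : Continuous fun s => Real.exp (2 * ν * s) * ‖ι (u s)‖ ^ 2).aestronglyMeasurable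
  · refine Eventually.of_forall fun s => ?_
    rw [Real.norm_of_nonneg (by positivity)]
    simp only [Pi.add_apply]
    have h1 : ‖ι (u s)‖ ^ 2 ≤ 2 * (f s + ‖ι (v s)‖ ^ 2) := by
      have := norm_le_norm_sub_add (ι (u s)) (ι (v s))
      simp only [hf]
      nlinarith [norm_nonneg (ι (u s)), sq_nonneg (‖ι (u s) - ι (v s)‖ - ‖ι (v s)‖)]
    have := mul_le_mul_of_nonneg_left h1 (Real.exp_pos (2 * ν * s)).le
    linarith

/-- Amenable trajectories depend continuously on the coordinates of their present value. -/
lemma graph_close {φ : Semiflow E} {ι : E →L[ℝ] H} {P : E →L[ℝ] E →L[ℝ] ℝ} {δ τV ν : ℝ}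
    (hH3 : φ.IsH3 ι P δ τV ν) {τS C : ℝ} (hτS : 0 ≤ τS) (hC : 0 < C)
    (hS : ∀ v₁ v₂ : E, ‖φ.toFun τS v₁ - φ.toFun τS v₂‖ ≤ C * ‖ι v₁ - ι v₂‖)
    (ℓ : E →L[ℝ] ℂ) (hℓ : ∀ x, -‖ℓ x‖ ^ 2 ≤ P x x)
    {w : ℝ → E} (hw : φ.IsAmenableTrajectory ι ν w) {T : ℝ} (hT : 0 ≤ T) {ε : ℝ} (hε : 0 < ε) :
    ∃ κ : ℝ, 0 < κ ∧ ∀ u : ℝ → E, φ.IsAmenableTrajectory ι ν u → ‖ℓ (u 0) - ℓ (w 0)‖ < κ →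
      ‖u (-T) - w (-T)‖ < ε := by
  obtain ⟨D, hD, hpair⟩ := pair_key hH3 hτS hC hS
  have hwc := hw.1.1
  obtain ⟨κ₁, hκ₁, hun⟩ := φ.unif_near_compact
    ((isCompact_Icc (a := -T - 1) (b := -T)).image hwc) 1 ε hε
  set A := D * Real.exp (2 * ν * (0 - -T)) with hA
  have hApos : 0 < A := by positivity
  refine ⟨κ₁ / Real.sqrt A, by positivity, fun u hu hclose => ?_⟩
  obtain ⟨s, hs, hks⟩ := hpair u w hu hw (-T) 0 (by linarith)
  have h1 := hℓ (u 0 - w 0)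
  rw [map_sub] at h1
  have h2 : ‖u s - w s‖ ^ 2 ≤ A * ‖ℓ (u 0) - ℓ (w 0)‖ ^ 2 :=
    hks.trans (mul_le_mul_of_nonneg_left (by linarith) hApos.le)
  have h3 : ‖ℓ (u 0) - ℓ (w 0)‖ ^ 2 < (κ₁ / Real.sqrt A) ^ 2 :=
    pow_lt_pow_left₀ hclose (norm_nonneg _) two_ne_zero
  rw [div_pow, Real.sq_sqrt hApos.le, lt_div_iff₀ hApos] at h3
  have h4 : ‖u s - w s‖ < κ₁ := lt_of_pow_lt_pow_left₀ 2 hκ₁.le (by linarith)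
  rw [traj_eq hu.1 hs.2, traj_eq hw.1 hs.2]
  exact hun (w s) (mem_image_of_mem _ hs) _ (by linarith [hs.2]) (by linarith [hs.1]) _ h4

/-- Gap lemma. -/
lemma gap {φ : Semiflow E} {ι : E →L[ℝ] H} {P : E →L[ℝ] E →L[ℝ] ℝ} {δ τV ν : ℝ}
    (hH3 : φ.IsH3 ι P δ τV ν) {τS C : ℝ} (hτS : 0 ≤ τS) (hC : 0 < C)
    (hS : ∀ v₁ v₂ : E, ‖φ.toFun τS v₁ - φ.toFun τS v₂‖ ≤ C * ‖ι v₁ - ι v₂‖)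
    (hsym : ∀ x y, P x y = P y x) {γ : Set E} (hγ : IsCompact γ)
    (hback : ∀ p ∈ γ, ∃ w, φ.IsAmenableTrajectory ι ν w ∧ w 0 = p ∧ ∀ s ∈ Icc (-1 : ℝ) 0, w s ∈ γ)
    {η : ℝ} (hη : 0 < η) :
    ∃ κ : ℝ, 0 < κ ∧ κ ≤ η ∧ ∀ p ∈ γ, ∀ y : E, ‖y‖ < κ → ∀ u, φ.IsAmenableTrajectory ι ν u →
      0 ≤ P (p + y - u 0) (p + y - u 0) → ‖u 0 - p‖ ≤ 1 → ‖u 0 - p‖ < η := by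
  obtain ⟨D, hD, hpair⟩ := pair_key hH3 hτS hC hS
  obtain ⟨κ₁, hκ₁, hun⟩ := φ.unif_near_compact hγ 1 η hη
  set κ := min (min η 1) (κ₁ ^ 2 / (D * (3 * (‖P‖ + 1)))) with hκ
  have hκpos : 0 < κ := by
    have := norm_nonneg P
    positivity
  refine ⟨κ, hκpos, (min_le_left _ _).trans (min_le_left _ _), fun p hp y hy u hu hV hb => ?_⟩
  obtain ⟨w, hw, hw0, hws⟩ := hback p hp
  obtain ⟨s, hs, hks⟩ := hpair u w hu hw 0 0 le_rfl
  rw [hw0] at hks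
  simp only [sub_self, mul_zero, Real.exp_zero, mul_one, zero_sub] at hks hs
  set x := u 0 - p with hx
  have e1 : p + y - u 0 = y - x := by rw [hx]; abel
  rw [e1] at hV
  have e2 : P (y - x) (y - x) = P y y - 2 * P y x + P x x := by
    simp only [map_sub, ContinuousLinearMap.sub_apply]
    rw [hsym x y]; ring
  rw [e2] at hV
  have hPn := norm_nonneg P
  have hyn := norm_nonneg y
  have hxn := norm_nonneg x
  have hκ1 : κ ≤ 1 := (min_le_left _ _).trans (min_le_right _ _)
  have q1 : P y y ≤ ‖P‖ * κ := by
    refine (le_abs_self _).trans ((quad_le P y y).trans ?_)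
    calc ‖P‖ * ‖y‖ * ‖y‖ ≤ ‖P‖ * κ * 1 := by gcongr; linarith
      _ = _ := by ring
  have q2 : -P y x ≤ ‖P‖ * κ := by
    refine (neg_le_abs _).trans ((quad_le P y x).trans ?_)
    calc ‖P‖ * ‖y‖ * ‖x‖ ≤ ‖P‖ * κ * 1 := by gcongr
      _ = _ := by ring
  have q3 : -P x x ≤ 3 * ‖P‖ * κ := by linarith
  have q4 : κ * (D * (3 * (‖P‖ + 1))) ≤ κ₁ ^ 2 := by
    rw [← le_div_iff₀ (by positivity)]; exact min_le_right _ _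
  have q5 : ‖u s - w s‖ ^ 2 < κ₁ ^ 2 := by
    refine hks.trans_lt ?_
    have := mul_le_mul_of_nonneg_left q3 hD.le
    have : 0 < D * κ := by positivity
    nlinarith
  have h4 : ‖u s - w s‖ < κ₁ := lt_of_pow_lt_pow_left₀ 2 hκ₁.le q5
  rw [hx, ← hw0, traj_eq hu.1 hs.2, traj_eq hw.1 hs.2]
  exact hun (w s) (hws s hs) _ (by linarith [hs.2]) (by linarith [hs.1]) _ h4

/-- Facts about periodic orbits. -/
lemma orbit_facts {φ : Semiflow E} {γ : Set E} (hγ : φ.IsPeriodicOrbit γ) :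
    IsCompact γ ∧ γ.Nonempty ∧ (∀ t, 0 ≤ t → ∀ p ∈ γ, φ.toFun t p ∈ γ) ∧
      ∀ p ∈ γ, ∃ q ∈ γ, φ.toFun 1 q = p := by
  obtain ⟨v₀, ⟨-, σ, hσ, hper⟩, rfl⟩ := hγ
  have hn : ∀ n : ℕ, φ.toFun (n * σ) v₀ = v₀ := by
    intro n
    induction n with
    | zero => simp [φ.map_zero']
    | succ k ih =>
      have : ((k + 1 : ℕ) : ℝ) * σ = k * σ + σ := by push_cast; ring
      rw [this, φ.map_add' _ _ (by positivity) hσ.le, hper, ih]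
  refine ⟨?_, ⟨v₀, 0, le_rfl, φ.map_zero' _⟩, ?_, ?_⟩
  · have h1 : φ.orbit v₀ = (fun t => φ.toFun t v₀) '' Icc 0 σ := by
      ext p
      constructor
      · rintro ⟨t, ht, rfl⟩
        have h2 := Nat.floor_le (div_nonneg ht hσ.le)
        have h3 := Nat.lt_floor_add_one (t / σ)
        set n := ⌊t / σ⌋₊
        rw [le_div_iff₀ hσ] at h2
        rw [div_lt_iff₀ hσ] at h3
        refine ⟨t - n * σ, ⟨by linarith, by linarith⟩, ?_⟩
        have : t = (t - n * σ) + n * σ := by ring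
        conv_rhs => rw [this, φ.map_add' _ _ (by linarith) (by positivity), hn]
      · rintro ⟨t, ht, rfl⟩
        exact ⟨t, ht.1, rfl⟩
    rw [h1]
    exact isCompact_Icc.image_of_continuousOn
      ((φ.continuousOn_time v₀).mono (fun t ht => ht.1))
  · rintro t ht p ⟨r, hr, rfl⟩
    exact ⟨t + r, by linarith, φ.map_add' _ _ ht hr _⟩
  · rintro p ⟨r, hr, rfl⟩
    obtain ⟨n, hn1⟩ := exists_nat_ge (1 / σ)
    rw [div_le_iff₀ hσ] at hn1
    refine ⟨φ.toFun (r + n * σ - 1) v₀, ⟨_, by linarith, rfl⟩, ?_⟩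
    rw [← φ.map_add' _ _ zero_le_one (by linarith)]
    have : 1 + (r + n * σ - 1) = r + n * σ := by ring
    rw [this, φ.map_add' _ _ hr (by positivity), hn]

/-- Tracking lemma: points near `γ` are tracked on `[0, T]` by amenable points near `γ`. -/
lemma tracking {φ : Semiflow E} {ι : E →L[ℝ] H} {P : E →L[ℝ] E →L[ℝ] ℝ} {δ τV ν : ℝ}
    (hH3 : φ.IsH3 ι P δ τV ν) {τS C : ℝ} (hτS : 0 ≤ τS) (hC : 0 < C)
    (hS : ∀ v₁ v₂ : E, ‖φ.toFun τS v₁ - φ.toFun τS v₂‖ ≤ C * ‖ι v₁ - ι v₂‖)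
    (ℓ : E →L[ℝ] ℂ) (hℓ : ∀ x, -‖ℓ x‖ ^ 2 ≤ P x x)
    (hsurj : ∀ z, ∃ u : ℝ → E, φ.IsAmenableTrajectory ι ν u ∧ ℓ (u 0) = z)
    (hsym : ∀ x y, P x y = P y x) {γ : Set E} (hγ : IsCompact γ)
    (hback : ∀ p ∈ γ, ∃ w, φ.IsAmenableTrajectory ι ν w ∧ w 0 = p ∧ ∀ s ∈ Icc (-1 : ℝ) 0, w s ∈ γ)
    {η : ℝ} (hη : 0 < η) (hη1 : η ≤ 1) :
    ∃ κ : ℝ, 0 < κ ∧ κ ≤ η ∧ ∀ p ∈ γ, ∀ v : E, ‖v - p‖ < κ → ∀ T, τV ≤ T →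
      ∃ b ∈ φ.amenableSet ι ν, ‖b - p‖ < η ∧
        0 ≤ P (φ.toFun T v - φ.toFun T b) (φ.toFun T v - φ.toFun T b) := by
  obtain ⟨κ, hκ, hκη, hgap⟩ := gap hH3 hτS hC hS hsym hγ hback hη
  refine ⟨κ, hκ, hκη, fun p hp v hv T hT => ?_⟩
  have hT0 : 0 ≤ T := hH3.2.1.trans hT
  choose U hU hU0 using hsurj
  have hUc : Continuous (fun z => U z (-T)) := by
    rw [Metric.continuous_iff]
    intro z ε hε
    obtain ⟨κ', hκ', h⟩ := graph_close hH3 hτS hC hS ℓ hℓ (hU z) hT0 hε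
    refine ⟨κ', hκ', fun z' hz' => ?_⟩
    rw [dist_eq_norm] at hz' ⊢
    exact h (U z') (hU z') (by rw [hU0, hU0]; exact hz')
  have hcs := φ.continuous_space hT0
  set c : ℝ → E := fun θ => p + θ • (v - p) with hc
  set b : ℝ → E := fun θ => U (ℓ (φ.toFun T (c θ))) (-T) with hb
  have hbc : Continuous b := hUc.comp (by fun_prop)
  have hend : ∀ θ, 0 ≤ P (φ.toFun T (c θ) - φ.toFun T (b θ))
      (φ.toFun T (c θ) - φ.toFun T (b θ)) := by
    intro θ
    set z := ℓ (φ.toFun T (c θ)) with hz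
    have e1 : φ.toFun T (b θ) = U z 0 := by
      have := traj_eq (hU z).1 (l := -T) (r := 0) (by linarith)
      rw [this, zero_sub, neg_neg]
    have h1 := hℓ (φ.toFun T (c θ) - φ.toFun T (b θ))
    rw [map_sub, e1, hU0, ← hz, sub_self] at h1
    rw [e1]
    simpa using h1
  have hV : ∀ θ, 0 ≤ P (c θ - b θ) (c θ - b θ) := by
    intro θ
    have h1 := mono_of_H3 hH3 (c θ) (b θ) T hT
    have h4 : 0 ≤ ∫ s in (0 : ℝ)..T, Real.exp (2 * ν * s) *
          ‖ι (φ.toFun s (c θ)) - ι (φ.toFun s (b θ))‖ ^ 2 :=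
      intervalIntegral.integral_nonneg hT0 (fun s _ => by positivity)
    have h5 := mul_nonneg hH3.1.le h4
    have h6 := mul_nonneg (Real.exp_pos (2 * ν * T)).le (hend θ)
    linarith
  have hshift : ∀ θ, φ.IsAmenableTrajectory ι ν (fun s => U (ℓ (φ.toFun T (c θ))) (s + -T)) :=
    fun θ => amenable_shift (hU _) (-T)
  have hb0 : b 0 = p := by
    obtain ⟨w, hw, hw0, -⟩ := hback p hp
    have hw' := amenable_shift hw T
    have e1 : φ.toFun T (c 0) = w T := by
      have := traj_eq hw.1 (l := 0) (r := T) hT0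
      rw [this, sub_zero, hw0]; simp [hc]
    rw [← sub_eq_zero, ← norm_eq_zero]
    refine le_antisymm (le_of_forall_pos_le_add fun ε hε => ?_) (norm_nonneg _)
    obtain ⟨κ', hκ', h⟩ := graph_close hH3 hτS hC hS ℓ hℓ hw' hT0 hε
    have h2 := h _ (hU (ℓ (φ.toFun T (c 0)))) (by
      rw [hU0, e1]; simpa using hκ')
    simp only [neg_add_cancel, hw0] at h2
    rw [zero_add]
    exact h2.le
  have hg : ∀ θ ∈ Icc (0 : ℝ) 1, ‖b θ - p‖ ≤ 1 → ‖b θ - p‖ < η := by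
    intro θ hθ hle
    have h1 := hgap p hp (θ • (v - p)) (by
      rw [norm_smul, Real.norm_of_nonneg hθ.1]
      have := norm_nonneg (v - p)
      nlinarith [hθ.2, hθ.1]) _ (hshift θ)
    simp only [zero_add] at h1
    exact h1 (hV θ) hle
  have hfin : ‖b 1 - p‖ < η := by
    by_contra hcon
    push Not at hcon
    have hgc : ContinuousOn (fun θ => ‖b θ - p‖) (Icc 0 1) := by fun_prop
    obtain ⟨θ, hθ, hθη⟩ := intermediate_value_Icc zero_le_one hgc
      (show η ∈ Icc _ _ from ⟨by simp [hb0, hη.le], hcon⟩)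
    have h1 := hg θ hθ (by simp only at hθη; linarith)
    simp only at hθη
    linarith
  refine ⟨b 1, ⟨_, hshift 1, by simp [hb]⟩, hfin, ?_⟩
  have h1 := hend 1
  have e : c 1 = v := by simp [hc]
  rwa [e] at h1

end Aux

end Semiflow


/-- Lemma 5: an amenable stable periodic orbit is orbitally stable. -/
theorem orbitallyStable_of_amenableStable
    {E : Type*} [NormedAddCommGroup E] [NormedSpace ℝ E]
    {H : Type*} [NormedAddCommGroup H] [InnerProductSpace ℝ H]
    (ι : E →L[ℝ] H) (hι : Function.Injective ι)
    (φ : Semiflow E)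
    (P : E →L[ℝ] E →L[ℝ] ℝ) (Eplus Eminus : Submodule ℝ E)
    (hH1 : Semiflow.IsH1 P Eplus Eminus)
    [FiniteDimensional ℝ ↥Eminus] (hH2 : Module.finrank ℝ ↥Eminus = 2)
    (δ τV ν : ℝ) (hH3 : φ.IsH3 ι P δ τV ν)
    (hCOM : φ.IsCOM) (hS : φ.IsSmoothing ι)
    (γ₀ : Set E) (hγ₀ : φ.IsPeriodicOrbit γ₀) (hsub : γ₀ ⊆ φ.amenableSet ι ν)
    (hstab : φ.IsAmenableStable ι ν γ₀) :
    φ.IsOrbitallyStable γ₀ := by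
  obtain ⟨ℓ, m, hm, hℓ⟩ := exists_coords P Eplus Eminus hH1 hH2
  obtain ⟨τS, C, hτS, hC, hS⟩ := hS
  obtain ⟨hcomp, ⟨p₀, hp₀⟩, hinv, hpre⟩ := Semiflow.orbit_facts hγ₀
  have hτV := hH3.2.1
  have hν := hH3.2.2.1
  have hsurj : ∀ z, ∃ u : ℝ → E, φ.IsAmenableTrajectory ι ν u ∧ ℓ (u 0) = z := by
    intro z
    obtain ⟨v, hv, -⟩ := hsub hp₀
    exact Semiflow.exists_amenable_over hH3 hτS hC hS hCOM ℓ m hm hℓ hv z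
  have hback : ∀ p ∈ γ₀, ∃ w, φ.IsAmenableTrajectory ι ν w ∧ w 0 = p ∧
      ∀ s ∈ Icc (-1 : ℝ) 0, w s ∈ γ₀ := by
    intro p hp
    obtain ⟨q, hq, hqp⟩ := hpre p hp
    obtain ⟨u, hu, hu0⟩ := hsub hq
    have hut : ∀ t, 0 ≤ t → u t = φ.toFun t q := by
      intro t ht
      have := hu.1.2 t ht 0
      rwa [add_zero, hu0] at this
    refine ⟨_, Semiflow.amenable_shift hu 1, ?_, fun s hs => ?_⟩
    · simp only [zero_add]
      rw [hut 1 zero_le_one, hqp]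
    · rw [hut _ (by linarith [hs.1])]
      exact hinv _ (by linarith [hs.1]) q hq
  obtain ⟨c, hc, hkey⟩ := Semiflow.key_estimate hH3 hτS hC hS
  intro ε hε
  set T₀ := τV + 1 + τS with hT₀
  obtain ⟨κ₂, hκ₂, hun⟩ := φ.unif_near_compact hcomp (max 1 T₀) ε hε
  set ε₁ := κ₂ / 2 with hε₁
  have hε₁pos : 0 < ε₁ := by positivity
  obtain ⟨δs, hδs, hst⟩ := hstab ε₁ hε₁pos
  have hPn := norm_nonneg P
  set η := min (min 1 δs) (c * ε₁ ^ 2 / (8 * (‖P‖ + 1))) with hη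
  have hηpos : 0 < η := by positivity
  have hη1 : η ≤ 1 := (min_le_left _ _).trans (min_le_left _ _)
  have hηδ : η ≤ δs := (min_le_left _ _).trans (min_le_right _ _)
  have hηc : η * (8 * (‖P‖ + 1)) ≤ c * ε₁ ^ 2 := by
    rw [← le_div_iff₀ (by positivity)]; exact min_le_right _ _
  obtain ⟨κ, hκ, hκη, htrack⟩ := Semiflow.tracking hH3 hτS hC hS ℓ hℓ hsurj hH1.1 hcomp hback
    hηpos hη1
  refine ⟨min κ κ₂, by positivity, ?_⟩
  rintro v ⟨p, hp, hvp⟩ T hT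
  rcases le_total T T₀ with hTT | hTT
  · exact ⟨φ.toFun T p, hinv T hT p hp,
      hun p hp T hT (hTT.trans (le_max_right _ _)) v (hvp.trans_le (min_le_right _ _))⟩
  · have hvκ : ‖v - p‖ < κ := hvp.trans_le (min_le_left _ _)
    obtain ⟨b, hbA, hbp, hbV⟩ := htrack p hp v hvκ T (by linarith)
    obtain ⟨s, hs, hks⟩ := hkey v b T (T - τS - 1) (by linarith) (by linarith) (by linarith)
    have hs1 : T - 1 ≤ s := by linarith [hs.1]
    have hs2 : s ≤ T := by linarith [hs.2]
    have hs0 : 0 ≤ s := by linarith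
    obtain ⟨q, hq, hqb⟩ := hst b ⟨⟨p, hp, hbp.trans_le hηδ⟩, hbA⟩ s hs0
    have hvb : ‖v - b‖ < 2 * η := by
      have := norm_sub_le (v - p) (b - p)
      rw [sub_sub_sub_cancel_right] at this
      linarith
    have hPvb : P (v - b) (v - b) ≤ ‖P‖ * (4 * η) := by
      refine (le_abs_self _).trans ((Semiflow.quad_le P _ _).trans ?_)
      have := norm_nonneg (v - b)
      calc ‖P‖ * ‖v - b‖ * ‖v - b‖ ≤ ‖P‖ * (2 * η) * 2 := by gcongr; linarith
        _ = _ := by ring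
    set Y := ‖φ.toFun s v - φ.toFun s b‖ with hY
    have hexp : 1 ≤ Real.exp (2 * ν * (T - τS - 1)) :=
      Real.one_le_exp (mul_nonneg (by linarith) (by linarith))
    have h1 := mul_nonneg (Real.exp_pos (2 * ν * T)).le hbV
    have h2 : c * Y ^ 2 ≤ c * (Real.exp (2 * ν * (T - τS - 1)) * Y ^ 2) := by
      refine mul_le_mul_of_nonneg_left ?_ hc.le
      nlinarith [sq_nonneg Y]
    have h3 : c * Y ^ 2 < c * ε₁ ^ 2 := by nlinarith
    have h4 : Y < ε₁ := lt_of_pow_lt_pow_left₀ 2 hε₁pos.le (lt_of_mul_lt_mul_left h3 hc.le)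
    have h5 : ‖φ.toFun s v - q‖ < κ₂ := by
      have := norm_sub_le_norm_sub_add_norm_sub (φ.toFun s v) (φ.toFun s b) q
      linarith
    refine ⟨φ.toFun (T - s) q, hinv _ (by linarith) q hq, ?_⟩
    have h6 := hun q hq (T - s) (by linarith) ((by linarith : T - s ≤ 1).trans (le_max_left _ _))
      _ h5
    rwa [← φ.map_add' _ _ (by linarith) hs0, sub_add_cancel] at h6
end

section
/- Let φ be a semiflow on E satisfying (H1) and (H3) with τ_V = 0, and set C_V := {v ∈ E : ⟨v, Pv⟩ ≤ 0}. If v₁, v₂ ∈ E are distinct points with v₁ − v₂ ∈ C_V, then ⟨φ^t(v₁) − φ^t(v₂), P(φ^t(v₁) − φ^t(v₂))⟩ < 0 for every t > 0; in particular φ^t(v₁) − φ^t(v₂) lies in the interior of C_V for all t > 0. -/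
open Set Filter Topology MeasureTheory Bornology

/-- Strict monotonicity with respect to the quadratic cone `C_V = {V ≤ 0}`: under (H1)
and (H3) with `τ_V = 0`, if `v₁ ≠ v₂` and `v₁ − v₂ ∈ C_V`, then
`V(φ^t(v₁) − φ^t(v₂)) < 0` for all `t > 0`, so the difference lies in the interior
of `C_V`. -/
theorem strict_monotonicity_cone
    {E : Type*} [NormedAddCommGroup E] [NormedSpace ℝ E]
    {H : Type*} [NormedAddCommGroup H] [InnerProductSpace ℝ H]
    (ι : E →L[ℝ] H) (hι : Function.Injective ι)
    (φ : Semiflow E)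
    (P : E →L[ℝ] E →L[ℝ] ℝ) (Eplus Eminus : Submodule ℝ E)
    (hH1 : Semiflow.IsH1 P Eplus Eminus)
    (δ ν : ℝ) (hH3 : φ.IsH3 ι P δ 0 ν)
    (v₁ v₂ : E) (hne : v₁ ≠ v₂) (hcone : P (v₁ - v₂) (v₁ - v₂) ≤ 0) :
    ∀ t : ℝ, 0 < t →
      P (φ.toFun t v₁ - φ.toFun t v₂) (φ.toFun t v₁ - φ.toFun t v₂) < 0 ∧
      φ.toFun t v₁ - φ.toFun t v₂ ∈ interior {v : E | P v v ≤ 0} := by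
  intro t ht
  obtain ⟨hδ, -, -, h⟩ := hH3
  have hφ : ∀ v : E, ContinuousOn (fun s => φ.toFun s v) (Set.Icc 0 t) := by
    intro v
    have := φ.continuousOn'.comp (f := fun s : ℝ => (s, v)) (s := Set.Icc 0 t)
      (by fun_prop) (fun s hs => ⟨hs.1, Set.mem_univ _⟩)
    exact this
  have hcont : ContinuousOn (fun s => Real.exp (2 * ν * s) *
      ‖ι (φ.toFun s v₁) - ι (φ.toFun s v₂)‖ ^ 2) (Set.Icc 0 t) := by
    have h1 := ι.continuous.comp_continuousOn (hφ v₁)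
    have h2 := ι.continuous.comp_continuousOn (hφ v₂)
    exact (by fun_prop : Continuous fun s : ℝ => Real.exp (2 * ν * s)).continuousOn.mul
      ((h1.sub h2).norm.pow 2)
  have hpos : 0 < ∫ s in (0 : ℝ)..t, Real.exp (2 * ν * s) *
      ‖ι (φ.toFun s v₁) - ι (φ.toFun s v₂)‖ ^ 2 := by
    refine intervalIntegral.integral_pos ht hcont (fun s _ => by positivity)
      ⟨0, ⟨le_rfl, ht.le⟩, ?_⟩
    rw [φ.map_zero', φ.map_zero']
    have : 0 < ‖ι v₁ - ι v₂‖ := norm_pos_iff.2 (sub_ne_zero.2 (hι.ne hne))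
    positivity
  have key := h v₁ v₂ 0 t le_rfl ht.le (by linarith)
  rw [φ.map_zero', φ.map_zero'] at key
  have hneg : P (φ.toFun t v₁ - φ.toFun t v₂) (φ.toFun t v₁ - φ.toFun t v₂) < 0 := by
    have h3 := mul_pos hδ hpos
    simp only [mul_zero, Real.exp_zero, one_mul] at key
    by_contra hc
    have h4 := mul_nonneg (Real.exp_pos (2 * ν * t)).le (not_lt.1 hc)
    linarith
  refine ⟨hneg, ?_⟩
  have hopen : IsOpen {v : E | P v v < 0} := isOpen_lt (by fun_prop) continuous_const
  exact interior_maximal (fun v (hv : P v v < 0) => hv.le) hopen hneg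
end
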